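/- (Gabor matrix expansion of an operator, Proposition 2.4.) Let T : 𝓢(ℝ^d) → L²(ℝ^d) be a linear map such that for every v ∈ 𝓢(ℝ^d) there is a constant C(v) with |(v, Tφ)_{L²}| ≤ C(v)‖φ‖_{L²} for all φ ∈ 𝓢(ℝ^d). Define the matrix M[T]_{α̃,β̃} := (G^A_{α̃}, T G^A_{β̃})_{L²} for α̃,β̃ ∈ Γ̃. Then for every φ ∈ 𝓢(ℝ^d): (a) for each α̃ ∈ Γ̃ the series a_{α̃} := ∑_{β̃∈Γ̃} M[T]_{α̃,β̃} (G^A_{β̃}, φ)_{L²} converges absolutely; (b) the family (a_{α̃})_{α̃} belongs to ℓ²(Γ̃); (c) the family (a_{α̃} G^A_{α̃})_{α̃} is summable in L²(ℝ^d) with sum Tφ, i.e. Tφ = ∑_{α̃∈Γ̃} a_{α̃} G^A_{α̃} in L²-norm. -/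

import Mathlib

open MeasureTheory Complex
open scoped BigOperators ComplexConjugate ComplexInnerProductSpace

noncomputable section

/-- Euclidean dot product on `ℝ^d` (realized as `Fin d → ℝ`). -/
def dotR {d : ℕ} (x y : Fin d → ℝ) : ℝ := ∑ i, x i * y i

/-- Japanese bracket `⟨x⟩ = (1+|x|²)^(1/2)` (Euclidean norm). -/
def jap {d : ℕ} (x : Fin d → ℝ) : ℝ := Real.sqrt (1 + dotR x x)

/-- Euclidean norm on `ℝ^d`. -/
def enr {d : ℕ} (x : Fin d → ℝ) : ℝ := Real.sqrt (dotR x x)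

/-- Embedding of the lattice `ℤ^d` into `ℝ^d`. -/
def zToR {d : ℕ} (γ : Fin d → ℤ) : Fin d → ℝ := fun i => (γ i : ℝ)

/-- The point `2πk` of the dual lattice `(2πℤ)^d`, for `k ∈ ℤ^d`. -/
def dualV {d : ℕ} (k : Fin d → ℤ) : Fin d → ℝ := fun i => 2 * Real.pi * (k i : ℝ)

/-- The magnetic phase `Λ^A(x,y) = exp(−i ∫₀¹ ⟨A(x+t(y−x)), y−x⟩ dt)`. -/
def magPhase {d : ℕ} (A : (Fin d → ℝ) → (Fin d → ℝ)) (x y : Fin d → ℝ) : ℂ :=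
  Complex.exp (-Complex.I *
    ((∫ t in (0:ℝ)..1, dotR (A (x + t • (y - x))) (y - x)) : ℝ))

/-- The magnetic Gabor frame function
`G^A_{γ,γ*}(x) = Λ^A(x,γ) θ_{γ*}(x−γ) g(x−γ)` with `γ* = 2πk`. -/
def gaborF {d : ℕ} (A : (Fin d → ℝ) → (Fin d → ℝ)) (g : (Fin d → ℝ) → ℝ)
    (γ k : Fin d → ℤ) (x : Fin d → ℝ) : ℂ :=
  magPhase A x (zToR γ) * (((2 * Real.pi) ^ (-(d : ℝ) / 2) : ℝ) : ℂ) *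
    Complex.exp (Complex.I * ((dotR (dualV k) (x - zToR γ) / (2 * Real.pi) : ℝ) : ℂ)) *
    ((g (x - zToR γ) : ℝ) : ℂ)

/-- `g` is a smooth `[0,1]`-valued quadratic partition of unity with support in `(−1,1)^d`. -/
def IsQuadPartition {d : ℕ} (g : (Fin d → ℝ) → ℝ) : Prop :=
  ContDiff ℝ (⊤ : ℕ∞) g ∧ (∀ x, g x ∈ Set.Icc (0:ℝ) 1) ∧
    tsupport g ⊆ Set.univ.pi (fun _ : Fin d => Set.Ioo (-1:ℝ) 1) ∧
    ∀ x, HasSum (fun γ : Fin d → ℤ => (g (x - zToR γ)) ^ 2) 1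

/-- Iterated directional derivative along a list of directions. -/
def dList {E F : Type*} [NormedAddCommGroup E] [NormedSpace ℝ E]
    [NormedAddCommGroup F] [NormedSpace ℝ F] : List E → (E → F) → (E → F)
  | [], f => f
  | v :: L, f => fun x => fderiv ℝ (dList L f) x v

/-- Direction of differentiation in the first (position) variable. -/
def dirX {d : ℕ} (j : Fin d) : (Fin d → ℝ) × (Fin d → ℝ) := (Pi.single j 1, 0)

/-- Direction of differentiation in the second (momentum) variable. -/
def dirXi {d : ℕ} (j : Fin d) : (Fin d → ℝ) × (Fin d → ℝ) := (0, Pi.single j 1)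

/-- The Hörmander class `S^p_0(ℝ^{2d})`. -/
def HormClass (d : ℕ) (p : ℝ) (Φ : ((Fin d → ℝ) × (Fin d → ℝ)) → ℂ) : Prop :=
  ContDiff ℝ (⊤ : ℕ∞) Φ ∧
    ∀ a b : List (Fin d), ∃ C : ℝ,
      ∀ x ξ : Fin d → ℝ,
        ‖dList (a.map dirX ++ b.map dirXi) Φ (x, ξ)‖ ≤ C * jap ξ ^ p

/-- The magnetic field `B_{jk} = ∂_j A_k − ∂_k A_j` of a vector potential `A`. -/
def Bof {d : ℕ} (A : (Fin d → ℝ) → (Fin d → ℝ)) (j k : Fin d) (x : Fin d → ℝ) : ℝ :=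
  fderiv ℝ A x (Pi.single j 1) k - fderiv ℝ A x (Pi.single k 1) j

/-- Each component `B j k` is bounded together with all its partial derivatives. -/
def BBounded {d : ℕ} (B : Fin d → Fin d → (Fin d → ℝ) → ℝ) : Prop :=
  ∀ j k : Fin d, ∀ L : List (Fin d), ∃ C : ℝ,
    ∀ x, ‖dList (L.map (fun i => Pi.single i (1:ℝ))) (B j k) x‖ ≤ C

/-- Flux of `B` through the triangle with vertices `a, b, c`. -/
def fluxB {d : ℕ} (B : Fin d → Fin d → (Fin d → ℝ) → ℝ) (a b c : Fin d → ℝ) : ℝ :=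
  ∫ t in (0:ℝ)..1, ∫ s in (0:ℝ)..1,
    ∑ j, ∑ k, B j k (a + t • (b - a) + (s * t) • (c - b)) *
      ((b - a) j + s * (c - b) j) * (t * (c - b) k)

/-- `Ω^B(a,b,c) = exp(−i ∫_{⟨a,b,c⟩} B)`. -/
def OmegaB {d : ℕ} (B : Fin d → Fin d → (Fin d → ℝ) → ℝ) (a b c : Fin d → ℝ) : ℂ :=
  Complex.exp (-Complex.I * (fluxB B a b c : ℝ))

/-- A Parseval frame of a Hilbert space reconstructs every vector. -/
theorem hasSum_inner_smul_of_parseval {ι H : Type*} [NormedAddCommGroup H]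
    [InnerProductSpace ℂ H] [CompleteSpace H] (G : ι → H)
    (hG : ∀ f : H, HasSum (fun i => ‖(⟪G i, f⟫ : ℂ)‖ ^ 2) (‖f‖ ^ 2)) (f : H) :
    HasSum (fun i => (⟪G i, f⟫ : ℂ) • G i) f := by
  classical
  have hmem : ∀ f : H, Memℓp (fun i => (⟪G i, f⟫ : ℂ)) 2 := fun f =>
    (memℓp_gen_iff (by simp)).2 (by simpa using (hG f).summable)
  let U₀ : H →ₗ[ℂ] lp (fun _ : ι => ℂ) 2 :=
    { toFun := fun f => ⟨fun i => (⟪G i, f⟫ : ℂ), hmem f⟩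
      map_add' := fun x y => by ext i; exact inner_add_right _ _ _
      map_smul' := fun c x => by ext i; exact inner_smul_right _ _ _ }
  have hU₀ : ∀ f, ‖U₀ f‖ = ‖f‖ := fun f => by
    have h1 := lp.norm_rpow_eq_tsum (p := 2) (by simp) (U₀ f)
    have h2 : ‖U₀ f‖ ^ 2 = ‖f‖ ^ 2 := by
      rw [← (hG f).tsum_eq]
      simpa [U₀] using h1
    exact (sq_eq_sq₀ (norm_nonneg _) (norm_nonneg _)).1 h2
  let U : H →L[ℂ] lp (fun _ : ι => ℂ) 2 := (LinearIsometry.mk U₀ hU₀).toContinuousLinearMap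
  have hU : ∀ f i, U f i = (⟪G i, f⟫ : ℂ) := fun _ _ => rfl
  have hadj := (ContinuousLinearMap.norm_map_iff_adjoint_comp_self U).1 hU₀
  have key := (lp.hasSum_single (by simp) (U f)).mapL (ContinuousLinearMap.adjoint U)
  have hUf : ContinuousLinearMap.adjoint U (U f) = f := by
    simpa using congrArg (fun L => L f) hadj
  rw [hUf] at key
  convert key using 2 with i
  refine ext_inner_right ℂ fun v => ?_
  rw [ContinuousLinearMap.adjoint_inner_left, lp.inner_single_left, hU, hU, inner_smul_left]
  simp [mul_comm]

/-- Riesz representation of a functional that is bounded with respect to the norm pulled back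
along a linear map into a Hilbert space. -/
theorem exists_inner_eq_of_bound {V H : Type*} [AddCommGroup V] [Module ℂ V]
    [NormedAddCommGroup H] [InnerProductSpace ℂ H] [CompleteSpace H] (J : V →ₗ[ℂ] H)
    (ℓ : V →ₗ[ℂ] ℂ) (C : ℝ) (hC : ∀ ψ, ‖ℓ ψ‖ ≤ C * ‖J ψ‖) :
    ∃ w : H, ∀ ψ, ℓ ψ = ⟪w, J ψ⟫ := by
  obtain ⟨L, hL, -⟩ := exists_extension_norm_eq (LinearMap.range J) (ℓ.compLeftInverse J)
  refine ⟨(InnerProductSpace.toDual ℂ H).symm L, fun ψ => ?_⟩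
  rw [InnerProductSpace.toDual_symm_apply,
    ← LinearMap.compLeftInverse_apply_of_bdd ℓ J ⟨C, hC⟩ ψ _ rfl]
  exact (hL ⟨J ψ, ψ, rfl⟩).symm

attribute [local instance] instMeasureSpaceUnitAddCircle instIsProbabilityMeasureUnitAddCircleVolume

theorem mFourier_neg_coe {d : ℕ} (k : Fin d → ℤ) (x : Fin d → ℝ) :
    UnitAddTorus.mFourier (-k) (fun i => (x i : UnitAddCircle)) =
      Complex.exp (-(Complex.I * ((2 * Real.pi * dotR (zToR k) x : ℝ) : ℂ))) := by
  simp only [UnitAddTorus.mFourier, ContinuousMap.coe_mk, fourier_coe_apply, ← Complex.exp_sum]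
  congr 1
  simp only [dotR, zToR]
  push_cast
  rw [Finset.mul_sum, Finset.mul_sum, ← Finset.sum_neg_distrib]
  refine Finset.sum_congr rfl fun i _ => ?_
  simp; ring

/-- Parseval's identity for a function supported in the unit cube. -/
theorem hasSum_sq_norm_fourier_unitCube {d : ℕ} (h : (Fin d → ℝ) → ℂ) (hm : MemLp h 2)
    (hs : ∀ x, h x ≠ 0 → ∀ i, x i ∈ Set.Ioc (-(1 / 2) : ℝ) (-(1 / 2) + 1)) :
    HasSum (fun k : Fin d → ℤ =>
      ‖∫ x, Complex.exp (-(Complex.I * ((2 * Real.pi * dotR (zToR k) x : ℝ) : ℂ))) * h x‖ ^ 2)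
      (∫ x, ‖h x‖ ^ 2) := by
  set a : Fin d → ℝ := fun _ => -(1 / 2) with ha
  set S : Set (Fin d → ℝ) := {x | ∀ i, x i ∈ Set.Ioc (a i) (a i + 1)} with hS
  have hSm : MeasurableSet S := MeasurableSet.univ_pi' fun _ => measurableSet_Ioc
  set e := UnitAddTorus.measurableEquivPiIoc a
  set F : UnitAddTorus (Fin d) → ℂ := fun y => h (e y).1 with hF
  have hFx : ∀ x ∈ S, F (fun i => (x i : UnitAddCircle)) = h x := fun x hx => by
    have : e (fun i => (x i : UnitAddCircle)) = ⟨x, hx⟩ := e.apply_symm_apply ⟨x, hx⟩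
    simp [hF, this]
  have hmp : MeasurePreserving (fun y => ((e y).1 : Fin d → ℝ)) volume (volume.restrict S) :=
    (measurePreserving_subtype_coe hSm).comp (UnitAddTorus.measurePreserving_equivPiIoc a)
  have hFm : MemLp F 2 volume := (hm.restrict S).comp_measurePreserving hmp
  have key := UnitAddTorus.hasSum_sq_mFourierCoeff (hFm.toLp F)
  have hsupp : ∀ {E : Type} [NormedAddCommGroup E] [NormedSpace ℝ E] (u : (Fin d → ℝ) → E),
      (∀ x, h x = 0 → u x = 0) → ∫ x in S, u x = ∫ x, u x := fun u hu =>
    setIntegral_eq_integral_of_forall_compl_eq_zero fun x hx =>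
      hu x (by_contra fun h0 => hx (hs x h0))
  convert key using 1
  · ext k
    congr 2
    have : UnitAddTorus.mFourierCoeff (hFm.toLp F) k = UnitAddTorus.mFourierCoeff F k :=
      integral_congr_ae (by filter_upwards [hFm.coeFn_toLp] with y hy; rw [hy])
    rw [this, UnitAddTorus.mFourierCoeff_eq_integral F k a,
      ← hsupp _ fun x hx => by rw [hx, mul_zero]]
    exact setIntegral_congr_fun hSm fun x hx => by
      simp only [hFx x hx, mFourier_neg_coe, smul_eq_mul]
  · have : ∫ t, ‖(hFm.toLp F) t‖ ^ 2 = ∫ t, ‖F t‖ ^ 2 :=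
      integral_congr_ae (by filter_upwards [hFm.coeFn_toLp] with y hy; rw [hy])
    rw [this, UnitAddTorus.integral_preimage _ a, ← hsupp _ fun x hx => by simp [hx]]
    exact setIntegral_congr_fun hSm fun x hx => by simp only [hFx x hx]

/-- Parseval's identity for a function supported in a cube of side `2π` centred at `c`. -/
theorem hasSum_sq_norm_fourier_cube {d : ℕ} (c : Fin d → ℝ) (u : (Fin d → ℝ) → ℂ)
    (hu : MemLp u 2) (hs : ∀ x, u x ≠ 0 → ∀ i, x i - c i ∈ Set.Ioc (-Real.pi) Real.pi) :
    HasSum (fun k : Fin d → ℤ =>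
      ‖∫ x, Complex.exp (-(Complex.I * ((dotR (zToR k) (x - c) : ℝ) : ℂ))) * u x‖ ^ 2)
      ((2 * Real.pi) ^ d * ∫ x, ‖u x‖ ^ 2) := by
  have hpi : (0 : ℝ) < 2 * Real.pi := by positivity
  have hscale : ∀ {E : Type} [NormedAddCommGroup E] [NormedSpace ℝ E] (v : (Fin d → ℝ) → E),
      ∫ x, v x = (2 * Real.pi) ^ d • ∫ x, v ((2 * Real.pi) • x + c) := fun v => by
    rw [Measure.integral_comp_smul volume (fun x => v (x + c)), integral_add_right_eq_self,
      Module.finrank_fin_fun, abs_of_pos (by positivity), smul_smul,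
      mul_inv_cancel₀ (by positivity), one_smul]
  have hmap : Measure.map (fun x : Fin d → ℝ => (2 * Real.pi) • x) volume =
      ENNReal.ofReal |((2 * Real.pi) ^ d)⁻¹| • volume := by
    simpa using Measure.map_addHaar_smul (volume : Measure (Fin d → ℝ)) hpi.ne'
  have hm : MemLp (fun x => u ((2 * Real.pi) • x + c)) 2 := by
    have h1 : MemLp (fun x => u (x + c)) 2 :=
      hu.comp_measurePreserving (measurePreserving_add_right volume c)
    have h2 : MemLp (fun x => u (x + c)) 2
        (Measure.map (fun x : Fin d → ℝ => (2 * Real.pi) • x) volume) := by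
      rw [hmap]; exact h1.smul_measure ENNReal.ofReal_ne_top
    exact h2.comp_of_map (by fun_prop)
  have key := (hasSum_sq_norm_fourier_unitCube _ hm fun x hx i => by
    have := hs _ hx i
    simp only [Pi.add_apply, Pi.smul_apply, smul_eq_mul, add_sub_cancel_right, Set.mem_Ioc] at this
    constructor <;> nlinarith [Real.pi_pos]).mul_left (((2 * Real.pi) ^ d) ^ 2)
  rw [hscale (fun x => ‖u x‖ ^ 2), smul_eq_mul, ← mul_assoc, ← sq]
  refine key.congr_fun fun k => ?_
  rw [hscale, norm_smul, mul_pow, Real.norm_of_nonneg (by positivity)]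
  have hdot : ∀ x : Fin d → ℝ,
      dotR (zToR k) ((2 * Real.pi) • x + c - c) = 2 * Real.pi * dotR (zToR k) x := fun x => by
    simp only [dotR, add_sub_cancel_right, Pi.smul_apply, smul_eq_mul, Finset.mul_sum]
    exact Finset.sum_congr rfl fun i _ => by ring
  simp only [hdot]

theorem norm_magPhase {d : ℕ} (A : (Fin d → ℝ) → (Fin d → ℝ)) (x y : Fin d → ℝ) :
    ‖magPhase A x y‖ = 1 := by
  rw [magPhase, neg_mul, mul_comm, ← neg_mul, ← Complex.ofReal_neg, Complex.norm_exp_ofReal_mul_I]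

theorem dotR_dualV_div {d : ℕ} (k : Fin d → ℤ) (y : Fin d → ℝ) :
    dotR (dualV k) y / (2 * Real.pi) = dotR (zToR k) y := by
  simp only [dotR, dualV, zToR, Finset.sum_div]
  refine Finset.sum_congr rfl fun i _ => ?_
  field_simp

theorem gaborF_eq_exp_mul {d : ℕ} (A : (Fin d → ℝ) → (Fin d → ℝ)) (g : (Fin d → ℝ) → ℝ)
    (γ k : Fin d → ℤ) (x : Fin d → ℝ) :
    gaborF A g γ k x =
      Complex.exp (Complex.I * ((dotR (zToR k) (x - zToR γ) : ℝ) : ℂ)) * gaborF A g γ 0 x := by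
  have h0 : dotR (zToR (0 : Fin d → ℤ)) (x - zToR γ) = 0 := by simp [dotR, zToR]
  simp only [gaborF, dotR_dualV_div, h0]
  simp
  ring

theorem norm_gaborF_zero_sq {d : ℕ} (A : (Fin d → ℝ) → (Fin d → ℝ)) (g : (Fin d → ℝ) → ℝ)
    (γ : Fin d → ℤ) (x : Fin d → ℝ) :
    ‖gaborF A g γ 0 x‖ ^ 2 = ((2 * Real.pi) ^ d)⁻¹ * g (x - zToR γ) ^ 2 := by
  have h0 : dotR (zToR (0 : Fin d → ℤ)) (x - zToR γ) = 0 := by simp [dotR, zToR]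
  have hp : (((2 * Real.pi) ^ (-(d : ℝ) / 2) : ℝ)) ^ 2 = ((2 * Real.pi) ^ d)⁻¹ := by
    rw [← Real.rpow_natCast, ← Real.rpow_mul (by positivity), ← Real.rpow_natCast,
      ← Real.rpow_neg (by positivity)]
    congr 1
    push_cast
    ring
  rw [gaborF, dotR_dualV_div, h0, norm_mul, norm_mul, norm_mul, norm_magPhase, Complex.norm_real,
    Complex.norm_real, mul_pow, mul_pow, mul_pow, Real.norm_eq_abs, Real.norm_eq_abs, sq_abs,
    sq_abs, hp]
  simp

theorem integral_norm_sq_Lp {d : ℕ} (f : Lp ℂ 2 (volume : Measure (Fin d → ℝ))) :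
    ∫ x, ‖f x‖ ^ 2 = ‖f‖ ^ 2 := by
  rw [← inner_self_eq_norm_sq (𝕜 := ℂ), L2.inner_def, ← integral_re (L2.integrable_inner f f)]
  exact integral_congr_ae (.of_forall fun x => (inner_self_eq_norm_sq (𝕜 := ℂ) (f x)).symm)

/-- A quadratic partition of unity decomposes the integral of an integrable function. -/
theorem IsQuadPartition.hasSum_integral {d : ℕ} {g : (Fin d → ℝ) → ℝ} (hg : IsQuadPartition g)
    {F : (Fin d → ℝ) → ℝ} (hF : Integrable F) :
    HasSum (fun γ : Fin d → ℤ => ∫ x, g (x - zToR γ) ^ 2 * F x) (∫ x, F x) := by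
  have hsum : ∀ c x, HasSum (fun γ : Fin d → ℤ => g (x - zToR γ) ^ 2 * c) c := fun c x => by
    simpa using (hg.2.2.2 x).mul_right c
  have hcont : Continuous g := hg.1.continuous
  refine hasSum_integral_of_dominated_convergence
    (fun γ x => g (x - zToR γ) ^ 2 * ‖F x‖) (fun γ => ?_) (fun γ => ?_) ?_ ?_ ?_
  · exact (by fun_prop : Continuous fun x => g (x - zToR γ) ^ 2).aestronglyMeasurable.mul
      hF.aestronglyMeasurable
  · exact .of_forall fun x => by simp
  · exact .of_forall fun x => (hsum _ x).summable
  · simpa only [(hsum _ _).tsum_eq] using hF.norm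
  · exact .of_forall fun x => hsum _ x

/-- The magnetic Gabor family is a Parseval frame of `L²(ℝ^d)`. -/
theorem hasSum_sq_norm_inner_gabor {d : ℕ} (A : (Fin d → ℝ) → (Fin d → ℝ))
    {g : (Fin d → ℝ) → ℝ} (hg : IsQuadPartition g)
    (G : (Fin d → ℤ) × (Fin d → ℤ) → Lp ℂ 2 (volume : Measure (Fin d → ℝ)))
    (hG : ∀ γ k, G (γ, k) =ᵐ[volume] gaborF A g γ k)
    (f : Lp ℂ 2 (volume : Measure (Fin d → ℝ))) :
    HasSum (fun p => ‖(⟪G p, f⟫ : ℂ)‖ ^ 2) (‖f‖ ^ 2) := by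
  have hf2 : Integrable fun x => ‖f x‖ ^ 2 := (Lp.memLp f).integrable_norm_pow (by simp)
  have hfiber : ∀ γ, HasSum (fun k => ‖(⟪G (γ, k), f⟫ : ℂ)‖ ^ 2)
      (∫ x, g (x - zToR γ) ^ 2 * ‖f x‖ ^ 2) := fun γ => by
    have hnorm : ∀ x, ‖conj (gaborF A g γ 0 x) * f x‖ ^ 2 =
        ((2 * Real.pi) ^ d)⁻¹ * (g (x - zToR γ) ^ 2 * ‖f x‖ ^ 2) := fun x => by
      rw [norm_mul, RCLike.norm_conj, mul_pow, norm_gaborF_zero_sq, mul_assoc]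
    have hmeas : AEStronglyMeasurable (fun x => conj (gaborF A g γ 0 x) * f x) volume :=
      (Complex.continuous_conj.comp_aestronglyMeasurable
        ((Lp.aestronglyMeasurable (G (γ, 0))).congr (hG γ 0))).mul (Lp.aestronglyMeasurable f)
    have hu : MemLp (fun x => conj (gaborF A g γ 0 x) * f x) 2 := by
      refine (memLp_two_iff_integrable_sq_norm hmeas).2 ?_
      simp only [hnorm]
      refine (hf2.mono' ?_ (.of_forall fun x => ?_)).const_mul _
      · have hcont : Continuous g := hg.1.continuous
        exact (by fun_prop : Continuous fun x => g (x - zToR γ) ^ 2).aestronglyMeasurable.mul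
          hf2.aestronglyMeasurable
      · obtain ⟨h0, h1⟩ := hg.2.1 (x - zToR γ)
        rw [Real.norm_of_nonneg (by positivity)]
        exact mul_le_of_le_one_left (by positivity) (pow_le_one₀ h0 h1)
    have hsupp : ∀ x, conj (gaborF A g γ 0 x) * f x ≠ 0 →
        ∀ i, x i - zToR γ i ∈ Set.Ioc (-Real.pi) Real.pi := fun x hx i => by
      have hgx : g (x - zToR γ) ≠ 0 := fun h => hx (by simp [gaborF, h])
      obtain ⟨h1, h2⟩ := hg.2.2.1 (subset_tsupport g hgx) i (Set.mem_univ i)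
      simp only [Pi.sub_apply] at h1 h2
      constructor <;> linarith [Real.pi_gt_three]
    have key := hasSum_sq_norm_fourier_cube (zToR γ) _ hu hsupp
    simp only [hnorm, integral_const_mul] at key
    rw [mul_inv_cancel_left₀ (by positivity)] at key
    refine key.congr_fun fun k => ?_
    rw [L2.inner_def]
    congr 2
    refine integral_congr_ae ?_
    filter_upwards [hG γ k] with x hx
    rw [hx, gaborF_eq_exp_mul, RCLike.inner_apply, map_mul, ← Complex.exp_conj, map_mul,
      Complex.conj_I, Complex.conj_ofReal, neg_mul]
    ring
  have htot := hg.hasSum_integral hf2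
  rw [integral_norm_sq_Lp] at htot
  have hs : Summable fun p => ‖(⟪G p, f⟫ : ℂ)‖ ^ 2 :=
    (summable_prod_of_nonneg fun _ => sq_nonneg _).2
      ⟨fun γ => (hfiber γ).summable, by simpa only [(hfiber _).tsum_eq] using htot.summable⟩
  have := (hs.hasSum.prod_fiberwise hfiber).unique htot
  exact this ▸ hs.hasSum

/-- **Gabor matrix expansion of an operator** (Proposition 2.4): let `T : 𝓢(ℝ^d) → L²(ℝ^d)`
be linear with `|(v, Tφ)| ≤ C(v) ‖φ‖_{L²}` for every Schwartz `v`. With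
`M[T]_{aa,bb} = (G^A_{aa}, T G^A_{bb})_{L²}`, for every Schwartz `φ`:
(a) each series `a_{aa} = ∑_{bb} M[T]_{aa,bb} (G^A_{bb}, φ)` converges absolutely;
(b) `(a_{aa})_{aa} ∈ ℓ²(Γ̃)`;
(c) `∑_{aa} a_{aa} G^A_{aa} = Tφ`, summably in `L²`-norm.
Here `Gs` realizes the magnetic Gabor frame as Schwartz functions, and `toL2` is the
(injective) linear embedding of Schwartz functions into `L²` (a.e.-coincidence is assumed). -/
theorem gabor_matrix_expansion (d : ℕ) (hd : 1 ≤ d)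
    (A : (Fin d → ℝ) → (Fin d → ℝ)) (hA : Function.HasTemperateGrowth A)
    (g : (Fin d → ℝ) → ℝ) (hg : IsQuadPartition g)
    (Gs : ((Fin d → ℤ) × (Fin d → ℤ)) → SchwartzMap (Fin d → ℝ) ℂ)
    (hGs : ∀ γ k : Fin d → ℤ, ∀ x, Gs (γ, k) x = gaborF A g γ k x)
    (toL2 : SchwartzMap (Fin d → ℝ) ℂ →ₗ[ℂ] Lp ℂ 2 (volume : Measure (Fin d → ℝ)))
    (htoL2 : ∀ ψ : SchwartzMap (Fin d → ℝ) ℂ,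
      (toL2 ψ : (Fin d → ℝ) → ℂ) =ᵐ[volume] fun x => ψ x)
    (T : SchwartzMap (Fin d → ℝ) ℂ →ₗ[ℂ] Lp ℂ 2 (volume : Measure (Fin d → ℝ)))
    (hT : ∀ v : SchwartzMap (Fin d → ℝ) ℂ, ∃ C : ℝ,
      ∀ ψ : SchwartzMap (Fin d → ℝ) ℂ, ‖(⟪toL2 v, T ψ⟫ : ℂ)‖ ≤ C * ‖toL2 ψ‖)
    (φ : SchwartzMap (Fin d → ℝ) ℂ) :
    (∀ aa : (Fin d → ℤ) × (Fin d → ℤ),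
      Summable (fun bb : (Fin d → ℤ) × (Fin d → ℤ) =>
        ‖(⟪toL2 (Gs aa), T (Gs bb)⟫ : ℂ) * (⟪toL2 (Gs bb), toL2 φ⟫ : ℂ)‖)) ∧
    Memℓp (fun aa : (Fin d → ℤ) × (Fin d → ℤ) =>
      ∑' bb : (Fin d → ℤ) × (Fin d → ℤ),
        (⟪toL2 (Gs aa), T (Gs bb)⟫ : ℂ) * (⟪toL2 (Gs bb), toL2 φ⟫ : ℂ)) 2 ∧
    HasSum (fun aa : (Fin d → ℤ) × (Fin d → ℤ) =>
      (∑' bb : (Fin d → ℤ) × (Fin d → ℤ),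
        (⟪toL2 (Gs aa), T (Gs bb)⟫ : ℂ) * (⟪toL2 (Gs bb), toL2 φ⟫ : ℂ)) • toL2 (Gs aa))
      (T φ) := by
  have hpars := hasSum_sq_norm_inner_gabor A hg (fun p => toL2 (Gs p)) fun γ k => by
    filter_upwards [htoL2 (Gs (γ, k))] with x hx
    rw [hx, hGs]
  have hframe := hasSum_inner_smul_of_parseval _ hpars
  have hmat : ∀ aa, ∃ w : Lp ℂ 2 (volume : Measure (Fin d → ℝ)),
      ∀ ψ, (⟪toL2 (Gs aa), T ψ⟫ : ℂ) = ⟪w, toL2 ψ⟫ := fun aa => by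
    obtain ⟨C, hC⟩ := hT (Gs aa)
    exact exists_inner_eq_of_bound toL2 ((innerₛₗ ℂ (toL2 (Gs aa))).comp T) C hC
  choose w hw using hmat
  have hcoef : ∀ aa, HasSum (fun bb =>
      (⟪toL2 (Gs aa), T (Gs bb)⟫ : ℂ) * (⟪toL2 (Gs bb), toL2 φ⟫ : ℂ))
      (⟪toL2 (Gs aa), T φ⟫ : ℂ) := fun aa => by
    rw [hw aa φ]
    refine ((hframe (toL2 φ)).mapL (innerSL ℂ (w aa))).congr_fun fun bb => ?_
    rw [hw aa, innerSL_apply_apply, inner_smul_right, mul_comm]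
  simp only [(hcoef _).tsum_eq]
  refine ⟨fun aa => (hcoef aa).summable.norm, ?_, hframe (T φ)⟩
  exact (memℓp_gen_iff (by simp)).2 (by simpa using (hpars (T φ)).summable)
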